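/- arXiv:1910.03344 — 3 statements merged into one kernel-verified Lean document; each statement's English description precedes it below -/
import Mathlib

section
/- Fix m, n ∈ ℕ⁺, b ∈ ℝ^m, an m×m real matrix A, and a continuous σ : ℝ → ℝ. Define S : ℝ^m → ℝ^m by S(x) = σ•(Ax + b) (σ applied componentwise) and Φ : C(ℝ^m,ℝ^n) → C(ℝ^m,ℝ^n) by Φ(f) = f ∘ S. Then Φ is a well-defined continuous linear map, and the following are equivalent: (i) for each δ, ε > 0 and each f, g ∈ C(ℝ^m,ℝ^n) there is N ∈ ℕ⁺ such that {Φ^N(g̃) : d_ucc(g̃, g) < δ} ∩ {f̃ : d_ucc(f̃, f) < ε} ≠ ∅; (ii) σ is injective, A has full rank, and for every compact subset K ⊆ ℝ^m there exists N ∈ ℕ⁺ with S^N(K) ∩ K = ∅. -/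
/-- Euclidean norm on `ℝ^n` (as functions `Fin n → ℝ`). -/
noncomputable def eNorm {n : ℕ} (y : Fin n → ℝ) : ℝ := Real.sqrt (∑ i, (y i) ^ 2)

/-- `s_k(f,g) = sup_{x ∈ [-k,k]^m} ‖f(x) - g(x)‖` (valued in `ℝ≥0∞`). -/
noncomputable def sK {m n : ℕ} (k : ℕ) (f g : (Fin m → ℝ) → (Fin n → ℝ)) : ENNReal :=
  ⨆ x ∈ {x : Fin m → ℝ | ∀ i, |x i| ≤ (k : ℝ)}, ENNReal.ofReal (eNorm (f x - g x))

/-- The metric `d_ucc(f,g) = Σ_{k ≥ 1} 2^{-k} s_k/(1+s_k)` inducing uniform convergence on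
compact sets. -/
noncomputable def ducc {m n : ℕ} (f g : (Fin m → ℝ) → (Fin n → ℝ)) : ℝ :=
  ∑' k : ℕ, (1 / 2 : ℝ) ^ (k + 1) *
    (if sK (k + 1) f g = ⊤ then 1
     else (sK (k + 1) f g).toReal / (1 + (sK (k + 1) f g).toReal))

/-- The map `S(x) = σ•(Ax + b)` on `ℝ^m`. -/
noncomputable def affAct {m : ℕ} (σ : ℝ → ℝ) (A : Matrix (Fin m) (Fin m) ℝ)
    (b : Fin m → ℝ) : (Fin m → ℝ) → (Fin m → ℝ) :=
  fun x i => σ ((∑ j, A i j * x j) + b i)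

/-- The composition operator `Φ(f) = f ∘ σ•(A· + b)` on `C(ℝ^m, ℝ^n)`. -/
noncomputable def compOpA {m n : ℕ} (σ : ℝ → ℝ) (hσ : Continuous σ)
    (A : Matrix (Fin m) (Fin m) ℝ) (b : Fin m → ℝ) :
    C((Fin m → ℝ), (Fin n → ℝ)) → C((Fin m → ℝ), (Fin n → ℝ)) :=
  fun f => f.comp ⟨affAct σ A b,
    continuous_pi fun i => hσ.comp
      ((continuous_finset_sum _ fun j _ =>
        continuous_const.mul (continuous_apply j)).add continuous_const)⟩

/-- The `k`-th summand of `ducc`, without its weight. -/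
noncomputable def duccTerm {m n : ℕ} (k : ℕ) (f g : (Fin m → ℝ) → (Fin n → ℝ)) : ℝ :=
  if sK (k + 1) f g = ⊤ then 1
  else (sK (k + 1) f g).toReal / (1 + (sK (k + 1) f g).toReal)

theorem duccTerm_nonneg {m n : ℕ} (k : ℕ) (f g : (Fin m → ℝ) → (Fin n → ℝ)) :
    0 ≤ duccTerm k f g := by
  unfold duccTerm
  split_ifs <;> positivity

theorem duccTerm_le_one {m n : ℕ} (k : ℕ) (f g : (Fin m → ℝ) → (Fin n → ℝ)) :
    duccTerm k f g ≤ 1 := by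
  unfold duccTerm
  split_ifs
  · exact le_rfl
  · have h : 0 ≤ (sK (k + 1) f g).toReal := ENNReal.toReal_nonneg
    rw [div_le_one (by positivity)]
    linarith

theorem summable_half_pow_succ : Summable fun k : ℕ => (1 / 2 : ℝ) ^ (k + 1) :=
  (summable_nat_add_iff 1).2 summable_geometric_two

theorem summable_ducc {m n : ℕ} (f g : (Fin m → ℝ) → (Fin n → ℝ)) :
    Summable fun k : ℕ => (1 / 2 : ℝ) ^ (k + 1) * duccTerm k f g :=
  summable_half_pow_succ.of_nonneg_of_le
    (fun k => mul_nonneg (by positivity) (duccTerm_nonneg k f g))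
    (fun k => mul_le_of_le_one_right (by positivity) (duccTerm_le_one k f g))

theorem ducc_eq_tsum {m n : ℕ} (f g : (Fin m → ℝ) → (Fin n → ℝ)) :
    ducc f g = ∑' k : ℕ, (1 / 2 : ℝ) ^ (k + 1) * duccTerm k f g := rfl

theorem le_duccTerm_of_le_eNorm {m n : ℕ} {k : ℕ} {η : ℝ} (hη : 0 < η)
    {f g : (Fin m → ℝ) → (Fin n → ℝ)} {x : Fin m → ℝ} (hx : ∀ i, |x i| ≤ ((k + 1 : ℕ) : ℝ))
    (h : η ≤ eNorm (f x - g x)) : η / (1 + η) ≤ duccTerm k f g := by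
  have hle : ENNReal.ofReal η ≤ sK (k + 1) f g :=
    (ENNReal.ofReal_le_ofReal h).trans
      (le_iSup₂ (f := fun x (_ : x ∈ {x : Fin m → ℝ | ∀ i, |x i| ≤ ((k + 1 : ℕ) : ℝ)}) =>
        ENNReal.ofReal (eNorm (f x - g x))) x hx)
  unfold duccTerm
  split_ifs with htop
  · rw [div_le_one (by positivity)]
    linarith
  · have hs : η ≤ (sK (k + 1) f g).toReal := (ENNReal.ofReal_le_iff_le_toReal htop).1 hle
    rw [div_le_div_iff₀ (by positivity) (by positivity)]
    nlinarith

/-- Closeness in `ducc` forces uniform closeness on each cube. -/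
theorem exists_ducc_lt_imp_eNorm_lt {m n : ℕ} (k : ℕ) {η : ℝ} (hη : 0 < η) :
    ∃ δ > (0 : ℝ), ∀ f g : (Fin m → ℝ) → (Fin n → ℝ), ducc f g < δ →
      ∀ x : Fin m → ℝ, (∀ i, |x i| ≤ (k : ℝ)) → eNorm (f x - g x) < η := by
  refine ⟨(1 / 2) ^ (k + 1) * (η / (1 + η)), by positivity, fun f g h x hx => ?_⟩
  by_contra! hc
  have hx' : ∀ i, |x i| ≤ ((k + 1 : ℕ) : ℝ) := fun i =>
    (hx i).trans (by exact_mod_cast k.le_succ)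
  refine h.not_ge ?_
  calc (1 / 2 : ℝ) ^ (k + 1) * (η / (1 + η))
      ≤ (1 / 2) ^ (k + 1) * duccTerm k f g := by
        gcongr
        exact le_duccTerm_of_le_eNorm hη hx' hc
    _ ≤ ducc f g := (summable_ducc f g).le_tsum k fun j _ =>
        mul_nonneg (by positivity) (duccTerm_nonneg j f g)

theorem duccTerm_eq_zero {m n : ℕ} {k : ℕ} {f g : (Fin m → ℝ) → (Fin n → ℝ)}
    (h : ∀ x : Fin m → ℝ, (∀ i, |x i| ≤ ((k + 1 : ℕ) : ℝ)) → f x = g x) :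
    duccTerm k f g = 0 := by
  have hs : sK (k + 1) f g = 0 := by
    simp only [sK, ENNReal.iSup_eq_zero]
    intro x hx
    simp [h x hx, eNorm]
  simp [duccTerm, hs]

/-- Agreement on a large enough cube forces closeness in `ducc`. -/
theorem exists_forall_eq_imp_ducc_lt (m n : ℕ) {δ : ℝ} (hδ : 0 < δ) :
    ∃ k₀ : ℕ, ∀ k ≥ k₀, ∀ f g : (Fin m → ℝ) → (Fin n → ℝ),
      (∀ x : Fin m → ℝ, (∀ i, |x i| ≤ (k : ℝ)) → f x = g x) → ducc f g < δ := by
  obtain ⟨k₀, hk₀⟩ := exists_pow_lt_of_lt_one hδ (by norm_num : (1 / 2 : ℝ) < 1)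
  refine ⟨k₀, fun k hk f g h => ?_⟩
  have hzero : ∑ i ∈ Finset.range k, (1 / 2 : ℝ) ^ (i + 1) * duccTerm i f g = 0 := by
    refine Finset.sum_eq_zero fun i hi => ?_
    rw [duccTerm_eq_zero, mul_zero]
    refine fun x hx => h x fun j => (hx j).trans ?_
    exact_mod_cast Finset.mem_range.1 hi
  have htail : HasSum (fun i : ℕ => (1 / 2 : ℝ) ^ (i + k + 1)) ((1 / 2) ^ k) := by
    have h2 := hasSum_geometric_two.mul_left ((1 / 2 : ℝ) ^ (k + 1))
    have hsum : (1 / 2 : ℝ) ^ (k + 1) * 2 = (1 / 2) ^ k := by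
      rw [pow_succ]
      ring
    rw [hsum] at h2
    have hfun : (fun i : ℕ => (1 / 2 : ℝ) ^ (i + k + 1)) =
        fun i => (1 / 2 : ℝ) ^ (k + 1) * (1 / 2) ^ i := by
      funext i
      rw [← pow_add, add_assoc, add_comm]
    rw [hfun]
    exact h2
  rw [ducc_eq_tsum, ← (summable_ducc f g).sum_add_tsum_nat_add k, hzero, zero_add]
  calc ∑' i : ℕ, (1 / 2 : ℝ) ^ (i + k + 1) * duccTerm (i + k) f g
      ≤ ∑' i : ℕ, (1 / 2 : ℝ) ^ (i + k + 1) :=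
        ((summable_nat_add_iff k).2 (summable_ducc f g)).tsum_le_tsum
          (fun i => mul_le_of_le_one_right (by positivity) (duccTerm_le_one _ f g))
          htail.summable
    _ = (1 / 2) ^ k := htail.tsum_eq
    _ ≤ (1 / 2) ^ k₀ := pow_le_pow_of_le_one (by norm_num) (by norm_num) hk
    _ < δ := hk₀

theorem abs_apply_le_eNorm {n : ℕ} (y : Fin n → ℝ) (i : Fin n) : |y i| ≤ eNorm y := by
  rw [← Real.sqrt_sq_eq_abs]
  exact Real.sqrt_le_sqrt
    (Finset.single_le_sum (f := fun i => y i ^ 2) (fun j _ => sq_nonneg _) (Finset.mem_univ i))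

theorem exists_nat_abs_apply_le {m : ℕ} {K : Set (Fin m → ℝ)} (hK : IsCompact K) :
    ∃ k : ℕ, ∀ x ∈ K, ∀ i, |x i| ≤ (k : ℝ) := by
  obtain ⟨C, hC⟩ := hK.isBounded.exists_norm_le
  obtain ⟨k, hk⟩ := exists_nat_ge C
  exact ⟨k, fun x hx i => (norm_le_pi_norm x i).trans ((hC x hx).trans hk)⟩

theorem isCompact_cube (m : ℕ) (r : ℝ) : IsCompact {x : Fin m → ℝ | ∀ i, |x i| ≤ r} := by
  have h : {x : Fin m → ℝ | ∀ i, |x i| ≤ r} = Set.univ.pi fun _ => Set.Icc (-r) r := by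
    ext x
    simp only [Set.mem_ofPred_eq, Set.mem_univ_pi, Set.mem_Icc, abs_le]
  rw [h]
  exact isCompact_univ_pi fun _ => isCompact_Icc

theorem continuous_affAct {m : ℕ} {σ : ℝ → ℝ} (hσ : Continuous σ)
    (A : Matrix (Fin m) (Fin m) ℝ) (b : Fin m → ℝ) : Continuous (affAct σ A b) := by
  unfold affAct
  fun_prop

theorem affAct_apply_eq_mulVec {m : ℕ} (σ : ℝ → ℝ) (A : Matrix (Fin m) (Fin m) ℝ)
    (b x : Fin m → ℝ) (i : Fin m) : affAct σ A b x i = σ ((A.mulVec x) i + b i) := rfl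

theorem compOpA_iterate_apply {m n : ℕ} (σ : ℝ → ℝ) (hσ : Continuous σ)
    (A : Matrix (Fin m) (Fin m) ℝ) (b : Fin m → ℝ) (N : ℕ)
    (f : C((Fin m → ℝ), (Fin n → ℝ))) (x : Fin m → ℝ) :
    ((compOpA σ hσ A b)^[N] f) x = f ((affAct σ A b)^[N] x) := by
  induction N generalizing x with
  | zero => rfl
  | succ N ih =>
    rw [Function.iterate_succ_apply', Function.iterate_succ_apply]
    exact ih (affAct σ A b x)

theorem mulVec_injective_iff_rank_eq {m : ℕ} (A : Matrix (Fin m) (Fin m) ℝ) :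
    Function.Injective A.mulVec ↔ A.rank = m := by
  rw [Matrix.mulVec_injective_iff, Matrix.rank_eq_finrank_span_cols,
    linearIndependent_iff_card_eq_finrank_span, Fintype.card_fin, Set.finrank, eq_comm]

theorem affAct_injective_iff {m : ℕ} (hm : 0 < m) (σ : ℝ → ℝ) (A : Matrix (Fin m) (Fin m) ℝ)
    (b : Fin m → ℝ) :
    Function.Injective (affAct σ A b) ↔ Function.Injective σ ∧ A.rank = m := by
  rw [← mulVec_injective_iff_rank_eq]
  constructor
  · intro h
    have hA : Function.Injective A.mulVec := fun x y hxy => h <| by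
      ext i
      rw [affAct_apply_eq_mulVec, affAct_apply_eq_mulVec, hxy]
    have hsurj : Function.Surjective A.mulVec :=
      (LinearMap.injective_iff_surjective (f := A.mulVecLin)).1 hA
    refine ⟨fun s t hst => ?_, hA⟩
    obtain ⟨x, hx⟩ := hsurj ((fun _ => s) - b)
    obtain ⟨y, hy⟩ := hsurj ((fun _ => t) - b)
    have hxy : x = y := h <| by
      ext i
      simp [affAct_apply_eq_mulVec, hx, hy, hst]
    have := congrFun (hx.symm.trans ((congrArg A.mulVec hxy).trans hy)) ⟨0, hm⟩
    simpa using this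
  · rintro ⟨hs, hA⟩ x y hxy
    refine hA (funext fun i => ?_)
    exact add_right_cancel (hs (congrFun hxy i))

/-- Values on a compact set and on a disjoint injective continuous image of it can be prescribed
independently by one continuous map. -/
theorem exists_continuousMap_eqOn_and_comp_eqOn {X : Type*} [TopologicalSpace X] [T4Space X]
    {n : ℕ} {K : Set X} (hK : IsCompact K) {T : X → X} (hT : Continuous T)
    (hinj : Function.Injective T) (hdisj : T '' K ∩ K = ∅) (f g : C(X, Fin n → ℝ)) :
    ∃ h : C(X, Fin n → ℝ), (∀ x ∈ K, h x = g x) ∧ ∀ x ∈ K, h (T x) = f x := by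
  have : CompactSpace K := isCompact_iff_compactSpace.1 hK
  have hne : ∀ x y : K, (x : X) ≠ T y := fun x y hxy =>
    (Set.eq_empty_iff_forall_notMem.1 hdisj) x ⟨⟨y, y.2, hxy.symm⟩, x.2⟩
  let e : K ⊕ K → X := Sum.elim Subtype.val (T ∘ Subtype.val)
  have hec : Continuous e := continuous_subtype_val.sumElim (hT.comp continuous_subtype_val)
  have hei : Function.Injective e :=
    Subtype.val_injective.sumElim (hinj.comp Subtype.val_injective) hne
  let φ : C(K ⊕ K, Fin n → ℝ) :=
    ⟨Sum.elim (g ∘ Subtype.val) (f ∘ Subtype.val),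
      (g.continuous.comp continuous_subtype_val).sumElim
        (f.continuous.comp continuous_subtype_val)⟩
  obtain ⟨h, hh⟩ := φ.exists_extension (hec.isClosedEmbedding hei)
  have hval : ∀ z, h (e z) = φ z := DFunLike.congr_fun hh
  exact ⟨h, fun x hx => hval (Sum.inl ⟨x, hx⟩), fun x hx => hval (Sum.inr ⟨x, hx⟩)⟩

/-- Topological transitivity of the composition operator makes the underlying map injective. -/
theorem affAct_injective_of_transitive {m n : ℕ} (hn : 0 < n) (σ : ℝ → ℝ) (hσ : Continuous σ)
    (A : Matrix (Fin m) (Fin m) ℝ) (b : Fin m → ℝ)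
    (h : ∀ δ > (0 : ℝ), ∀ ε > (0 : ℝ), ∀ f g : C((Fin m → ℝ), (Fin n → ℝ)),
      ∃ N : ℕ, 0 < N ∧ ∃ gt : C((Fin m → ℝ), (Fin n → ℝ)),
        ducc ⇑gt ⇑g < δ ∧ ducc ⇑((compOpA σ hσ A b)^[N] gt) ⇑f < ε) :
    Function.Injective (affAct σ A b) := by
  intro x y hxy
  funext i
  by_contra hne
  obtain ⟨k, hk⟩ := exists_nat_abs_apply_le (Set.toFinite {x, y}).isCompact
  have hpos : 0 < |x i - y i| / 2 := half_pos (abs_pos.2 (sub_ne_zero.2 hne))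
  obtain ⟨ε, hε, hclose⟩ := exists_ducc_lt_imp_eNorm_lt (m := m) (n := n) k hpos
  let f : C((Fin m → ℝ), (Fin n → ℝ)) :=
    ⟨fun z _ => z i, continuous_pi fun _ => continuous_apply i⟩
  obtain ⟨N, hN, gt, -, hgt⟩ := h 1 one_pos ε hε f 0
  have hx := (abs_apply_le_eNorm _ ⟨0, hn⟩).trans_lt (hclose _ _ hgt x (hk x (by simp)))
  have hy := (abs_apply_le_eNorm _ ⟨0, hn⟩).trans_lt (hclose _ _ hgt y (hk y (by simp)))
  obtain ⟨M, rfl⟩ := Nat.exists_eq_succ_of_ne_zero hN.ne'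
  rw [compOpA_iterate_apply, Function.iterate_succ_apply, hxy] at hx
  rw [compOpA_iterate_apply, Function.iterate_succ_apply] at hy
  simp only [f, Pi.sub_apply, ContinuousMap.coe_mk] at hx hy
  have htri := abs_sub_le (x i) (gt ((affAct σ A b)^[M] (affAct σ A b y)) ⟨0, hn⟩) (y i)
  rw [abs_sub_comm (x i) (gt _ _)] at htri
  linarith

/-- Topological transitivity of the composition operator makes the underlying map run away from
every compact set. -/
theorem exists_iterate_image_inter_eq_empty_of_transitive {m n : ℕ} (hn : 0 < n) (σ : ℝ → ℝ)
    (hσ : Continuous σ) (A : Matrix (Fin m) (Fin m) ℝ) (b : Fin m → ℝ)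
    (h : ∀ δ > (0 : ℝ), ∀ ε > (0 : ℝ), ∀ f g : C((Fin m → ℝ), (Fin n → ℝ)),
      ∃ N : ℕ, 0 < N ∧ ∃ gt : C((Fin m → ℝ), (Fin n → ℝ)),
        ducc ⇑gt ⇑g < δ ∧ ducc ⇑((compOpA σ hσ A b)^[N] gt) ⇑f < ε)
    {K : Set (Fin m → ℝ)} (hK : IsCompact K) :
    ∃ N : ℕ, 0 < N ∧ (affAct σ A b)^[N] '' K ∩ K = ∅ := by
  obtain ⟨k, hk⟩ := exists_nat_abs_apply_le hK
  obtain ⟨ε, hε, hclose⟩ :=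
    exists_ducc_lt_imp_eNorm_lt (m := m) (n := n) k (half_pos one_pos)
  obtain ⟨N, hN, gt, hg, hf⟩ := h ε hε ε hε 1 0
  refine ⟨N, hN, Set.eq_empty_iff_forall_notMem.2 ?_⟩
  rintro _ ⟨⟨x, hx, rfl⟩, hy⟩
  have h0 := (abs_apply_le_eNorm _ ⟨0, hn⟩).trans_lt (hclose _ _ hg _ (hk _ hy))
  have h1 := (abs_apply_le_eNorm _ ⟨0, hn⟩).trans_lt (hclose _ _ hf x (hk x hx))
  rw [compOpA_iterate_apply] at h1
  simp only [Pi.sub_apply, ContinuousMap.zero_apply, ContinuousMap.one_apply, Pi.zero_apply,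
    Pi.one_apply, abs_lt] at h0 h1
  linarith [h0.2, h1.1]

/-- general characterization (Lemma B.1): topological transitivity of the
composition operator `f ↦ f ∘ σ•(A· + b)` on `C(ℝ^m, ℝ^n)` is equivalent to: `σ` injective,
`A` full rank, and every compact set is eventually moved off itself by `S = σ•(A· + b)`. -/
theorem stmt_8 {m n : ℕ} (hm : 0 < m) (hn : 0 < n)
    (σ : ℝ → ℝ) (hσ : Continuous σ)
    (A : Matrix (Fin m) (Fin m) ℝ) (b : Fin m → ℝ) :
    Continuous (compOpA (n := n) σ hσ A b) ∧
    (∀ f g : C((Fin m → ℝ), (Fin n → ℝ)),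
      compOpA σ hσ A b (f + g) = compOpA σ hσ A b f + compOpA σ hσ A b g) ∧
    (∀ (c : ℝ) (f : C((Fin m → ℝ), (Fin n → ℝ))),
      compOpA σ hσ A b (c • f) = c • compOpA σ hσ A b f) ∧
    ((∀ δ > (0 : ℝ), ∀ ε > (0 : ℝ), ∀ f g : C((Fin m → ℝ), (Fin n → ℝ)),
        ∃ N : ℕ, 0 < N ∧ ∃ gt : C((Fin m → ℝ), (Fin n → ℝ)),
          ducc ⇑gt ⇑g < δ ∧ ducc ⇑((compOpA σ hσ A b)^[N] gt) ⇑f < ε) ↔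
      (Function.Injective σ ∧ A.rank = m ∧
        ∀ K : Set (Fin m → ℝ), IsCompact K →
          ∃ N : ℕ, 0 < N ∧ (affAct σ A b)^[N] '' K ∩ K = ∅)) := by
  refine ⟨ContinuousMap.continuous_precomp _, fun _ _ => rfl, fun _ _ => rfl, fun h => ?_, ?_⟩
  · obtain ⟨hs, hA⟩ :=
      (affAct_injective_iff hm σ A b).1 (affAct_injective_of_transitive hn σ hσ A b h)
    exact ⟨hs, hA, fun K hK =>
      exists_iterate_image_inter_eq_empty_of_transitive hn σ hσ A b h hK⟩
  · rintro ⟨hs, hA, hrun⟩ δ hδ ε hε f g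
    have hinj := (affAct_injective_iff hm σ A b).2 ⟨hs, hA⟩
    obtain ⟨k₁, hk₁⟩ := exists_forall_eq_imp_ducc_lt m n hδ
    obtain ⟨k₂, hk₂⟩ := exists_forall_eq_imp_ducc_lt m n hε
    have hK := isCompact_cube m (max k₁ k₂ : ℕ)
    obtain ⟨N, hN, hdisj⟩ := hrun _ hK
    obtain ⟨gt, hg, hf⟩ := exists_continuousMap_eqOn_and_comp_eqOn hK
      ((continuous_affAct hσ A b).iterate N) (hinj.iterate N) hdisj f g
    refine ⟨N, hN, gt, hk₁ _ (le_max_left k₁ k₂) _ _ hg,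
      hk₂ _ (le_max_right k₁ k₂) _ _ ?_⟩
    intro x hx
    rw [compOpA_iterate_apply]
    exact hf x hx
end

section
/- Let m, n ∈ ℕ⁺ and let σ : ℝ → ℝ be continuous, non-affine, injective, without fixed points, and differentiable at at least one point with nonzero derivative at that point. Let F₁,…,F_N : C(ℝ^m,ℝ^n) → [0,∞) be continuous (for the compact-open topology on the domain) and let C₁,…,C_N > 0. Suppose there exists f₀ ∈ C(ℝ^m,ℝ^n) with F_n(f₀) < C_n for every n = 1,…,N. Then for every f ∈ C(ℝ^m,ℝ^n) and every ε > 0 there exist deep feed-forward networks f₁ and f₂ with activation σ, diagonal m×m matrices A₁,…,A_k, and vectors b₁,…,b_k ∈ ℝ^m such that: (i) the composition f₂ ∘ f₁ is well-defined; (ii) d_ucc(f, f₂ ∘ f₁) < ε; (iii) F_n(f₂) < C_n for every n = 1,…,N; (iv) f₁ = σ•(A_k · + b_k) ∘ ⋯ ∘ σ•(A₁ · + b₁). -/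
/-- `headNet σ A c k = σ•(A_{k-1}· + c_{k-1}) ∘ ⋯ ∘ σ•(A₀· + c₀)`. -/
noncomputable def headNet (σ : ℝ → ℝ) {m : ℕ} (A : ℕ → Matrix (Fin m) (Fin m) ℝ)
    (c : ℕ → (Fin m → ℝ)) : ℕ → (Fin m → ℝ) → (Fin m → ℝ)
  | 0 => fun x => x
  | (k + 1) => fun x i => σ ((A k).mulVec (headNet σ A c k x) i + c k i)

/-- Deep feed-forward networks with activation `σ`. -/
inductive IsNetwork (σ : ℝ → ℝ) : ∀ {m n : ℕ}, ((Fin m → ℝ) → (Fin n → ℝ)) → Prop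
  | affine {m n : ℕ} (A : Matrix (Fin n) (Fin m) ℝ) (b : Fin n → ℝ) :
      IsNetwork σ (fun x => A.mulVec x + b)
  | comp {m k n : ℕ} (A : Matrix (Fin k) (Fin m) ℝ) (b : Fin k → ℝ)
      (g : (Fin k → ℝ) → (Fin n → ℝ)) (hg : IsNetwork σ g) :
      IsNetwork σ (fun x => g (fun i => σ (A.mulVec x i + b i)))

open Filter Topology

namespace ContinuousMap

section CompactConvergence

variable {X Y : Type*} [TopologicalSpace X] [PseudoMetricSpace Y]

theorem hasBasis_nhds_dist (f : C(X, Y)) :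
    (𝓝 f).HasBasis (fun p : Set X × ℝ => IsCompact p.1 ∧ 0 < p.2)
      fun p => {g | ∀ x ∈ p.1, dist (g x) (f x) < p.2} := by
  have h := nhds_basis_uniformity'
    (Metric.uniformity_basis_dist (α := Y)).compactConvergenceUniformity (x := f)
  refine h.congr (fun _ => Iff.rfl) fun p _ => ?_
  ext g
  simp [dist_comm, UniformSpace.ball]

theorem mem_closure_iff_dist {S : Set C(X, Y)} {f : C(X, Y)} :
    f ∈ closure S ↔ ∀ K : Set X, IsCompact K → ∀ ε > 0, ∃ g ∈ S, ∀ x ∈ K, dist (g x) (f x) < ε := by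
  rw [mem_closure_iff_nhds_basis (hasBasis_nhds_dist f)]
  exact ⟨fun h K hK ε hε => h (i := (K, ε)) ⟨hK, hε⟩, fun h p hp => h p.1 hp.1 p.2 hp.2⟩

theorem exists_dist_lt_of_mem_closure {S : Set C(X, Y)} {f : C(X, Y)} (hf : f ∈ closure S)
    {K : Set X} (hK : IsCompact K) {ε : ℝ} (hε : 0 < ε) : ∃ g ∈ S, ∀ x ∈ K, dist (g x) (f x) < ε :=
  mem_closure_iff_dist.1 hf K hK ε hε

end CompactConvergence

/-- Precomposition with the affine map `x ↦ a * x + b`. -/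
def compAffine (f : C(ℝ, ℝ)) (a b : ℝ) : C(ℝ, ℝ) := ⟨fun x => f (a * x + b), by fun_prop⟩

/-- The integral `x ↦ ∫ s in 0..h, f (x + s)`. -/
noncomputable def slidingIntegral (f : C(ℝ, ℝ)) (h : ℝ) : C(ℝ, ℝ) :=
  ⟨fun x => ∫ s in (0 : ℝ)..h, f (x + s),
    intervalIntegral.continuous_parametric_intervalIntegral_of_continuous' (by fun_prop) 0 h⟩

theorem hasDerivAt_slidingIntegral (f : C(ℝ, ℝ)) (h x : ℝ) :
    HasDerivAt (f.slidingIntegral h) (f (x + h) - f x) x := by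
  have key : ⇑(f.slidingIntegral h) =
      fun y => (∫ s in (0 : ℝ)..(y + h), f s) - ∫ s in (0 : ℝ)..y, f s := by
    ext y
    have h1 : f.slidingIntegral h y = ∫ s in (0 : ℝ)..h, f (y + s) := rfl
    rw [h1, intervalIntegral.integral_comp_add_left, intervalIntegral.integral_interval_sub_left]
    · simp
    all_goals exact f.continuous.intervalIntegrable _ _
  rw [key]
  have hF (y : ℝ) : HasDerivAt (fun z => ∫ s in (0 : ℝ)..z, f s) (f y) y :=
    f.continuous.integral_hasStrictDerivAt 0 y |>.hasDerivAt
  exact ((hF (x + h)).comp_add_const x h).sub (hF x)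

theorem slidingIntegral_mem {V : Submodule ℝ C(ℝ, ℝ)} (hV : IsClosed (V : Set C(ℝ, ℝ)))
    (haff : ∀ f ∈ V, ∀ a b, f.compAffine a b ∈ V) {f : C(ℝ, ℝ)} (hf : f ∈ V) {h : ℝ} (hh : 0 < h) :
    f.slidingIntegral h ∈ V := by
  rw [← SetLike.mem_coe, ← hV.closure_eq, mem_closure_iff_dist]
  intro K hK ε hε
  have huc : UniformContinuousOn (fun p : ℝ × ℝ => f (p.1 + p.2)) (K ×ˢ Set.Icc 0 h) :=
    (hK.prod isCompact_Icc).uniformContinuousOn_of_continuous (by fun_prop)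
  obtain ⟨δ, hδ, H⟩ := Metric.uniformContinuousOn_iff.1 huc (ε / (2 * h)) (by positivity)
  obtain ⟨n, hn⟩ := exists_nat_gt (h / δ)
  have hn0 : (0 : ℝ) < n := lt_trans (by positivity) hn
  set η : ℝ := h / n with hη
  have hη0 : 0 < η := by positivity
  have hηn : n * η = h := by rw [hη]; field_simp
  have hηδ : η < δ := by rw [hη, div_lt_iff₀ hn0]; rwa [div_lt_iff₀ hδ, mul_comm] at hn
  refine ⟨∑ i ∈ Finset.range n, η • f.compAffine 1 (i * η),
    V.sum_mem fun i _ => V.smul_mem _ (haff f hf _ _), fun x hx => ?_⟩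
  have hsum : f.slidingIntegral h x =
      ∑ i ∈ Finset.range n, ∫ s in (i * η : ℝ)..((i + 1 : ℕ) * η : ℝ), f (x + s) := by
    rw [intervalIntegral.sum_integral_adjacent_intervals (a := fun i : ℕ => (i * η : ℝ))]
    · simp [slidingIntegral, hηn]
    · intro k _
      exact Continuous.intervalIntegrable (by fun_prop) _ _
  rw [hsum, coe_sum, Finset.sum_apply, dist_comm, Real.dist_eq, ← Finset.sum_sub_distrib]
  have hterm : ∀ i ∈ Finset.range n, |(∫ s in (i * η : ℝ)..((i + 1 : ℕ) * η : ℝ), f (x + s)) -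
      (η • f.compAffine 1 (i * η)) x| ≤ ε / (2 * h) * η := by
    intro i hi
    have hi' : (i : ℝ) + 1 ≤ n := by exact_mod_cast Finset.mem_range.1 hi
    have hle : (i * η : ℝ) ≤ (i + 1 : ℕ) * η := by push_cast; nlinarith
    have hend : ((i + 1 : ℕ) * η : ℝ) ≤ h := by
      push_cast; rw [← hηn]; exact mul_le_mul_of_nonneg_right hi' hη0.le
    have hstart : (0 : ℝ) ≤ i * η := by positivity
    have hconst : (η • f.compAffine 1 (i * η)) x =
        ∫ _ in (i * η : ℝ)..((i + 1 : ℕ) * η : ℝ), f (x + i * η) := by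
      rw [intervalIntegral.integral_const]
      simp [compAffine]
      left; ring
    rw [hconst, ← intervalIntegral.integral_sub
      (Continuous.intervalIntegrable (by fun_prop) _ _) (by simp)]
    have hb := intervalIntegral.norm_integral_le_of_norm_le_const (a := (i * η : ℝ))
      (b := ((i + 1 : ℕ) * η : ℝ)) (f := fun s => f (x + s) - f (x + i * η)) (C := ε / (2 * h)) ?_
    · rw [Real.norm_eq_abs] at hb
      refine hb.trans (le_of_eq ?_)
      rw [abs_of_nonneg (by linarith)]
      push_cast; ring
    · intro s hs
      rw [Set.uIoc_of_le hle] at hs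
      have h1 := hs.1
      have h2 := hs.2
      have := H (x, s) ⟨hx, by constructor <;> simp <;> linarith⟩ (x, i * η)
        ⟨hx, by constructor <;> simp <;> linarith⟩ ?_
      · exact this.le
      · rw [Prod.dist_eq, dist_self, Real.dist_eq, max_lt_iff]
        refine ⟨hδ, ?_⟩
        rw [abs_of_nonneg (by linarith)]
        push_cast at h2
        linarith
  calc _ ≤ ∑ i ∈ Finset.range n, ε / (2 * h) * η :=
        (Finset.abs_sum_le_sum_abs _ _).trans (Finset.sum_le_sum hterm)
    _ = ε / 2 := by
        rw [Finset.sum_const, Finset.card_range, nsmul_eq_mul]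
        rw [show (n : ℝ) * (ε / (2 * h) * η) = ε / (2 * h) * (n * η) by ring, hηn]
        field_simp
    _ < ε := by linarith

end ContinuousMap

theorem affine_of_second_difference_eq_zero {σ : ℝ → ℝ} (hσ : Continuous σ)
    (h : ∀ a t : ℝ, 0 < t → σ (a + t + t) - σ (a + t) - (σ (a + t) - σ a) = 0) :
    ∃ a b : ℝ, σ = fun x => a * x + b := by
  have hall : ∀ a t : ℝ, σ (a + t + t) - σ (a + t) - (σ (a + t) - σ a) = 0 := by
    intro a t
    rcases lt_trichotomy t 0 with ht | rfl | ht
    · have := h (a + t + t) (-t) (by linarith)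
      ring_nf at this ⊢
      linarith
    · simp
    · exact h a t ht
  have hmid : ∀ x y : ℝ, σ x + σ y = 2 * σ ((x + y) / 2) := by
    intro x y
    have := hall x ((y - x) / 2)
    rw [show x + (y - x) / 2 + (y - x) / 2 = y by ring,
      show x + (y - x) / 2 = (x + y) / 2 by ring] at this
    linarith
  let τ : ℝ →+ ℝ := AddMonoidHom.mk' (fun x => σ x - σ 0) fun x y => by
    have h1 := hmid x y
    have h2 := hmid (x + y) 0
    rw [add_zero] at h2
    linarith
  have hτ : Continuous τ := hσ.sub continuous_const
  refine ⟨σ 1 - σ 0, σ 0, funext fun x => ?_⟩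
  have := map_real_smul τ hτ x 1
  simp only [τ, AddMonoidHom.mk'_apply, smul_eq_mul, mul_one] at this
  linarith

theorem exists_abs_symmetric_second_difference_le {G G' : ℝ → ℝ} {a c : ℝ}
    (hG : ∀ x, HasDerivAt G (G' x) x) (hG' : HasDerivAt G' c a) {ε : ℝ} (hε : 0 < ε) :
    ∃ δ > 0, ∀ u, |u| < δ → |G (a + u) + G (a - u) - 2 * G a - c * u ^ 2| ≤ ε * u ^ 2 := by
  have h1 := (hasDerivAt_iff_isLittleO.1 hG').def (half_pos hε)
  obtain ⟨δ, hδ, H⟩ := Metric.eventually_nhds_iff.1 h1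
  refine ⟨δ, hδ, fun u hu => ?_⟩
  let P : ℝ → ℝ := fun u => G (a + u) + G (a - u) - 2 * G a - c * u ^ 2
  have hP : ∀ v, HasDerivAt P (G' (a + v) - G' (a - v) - 2 * c * v) v := by
    intro v
    have e1 := (hG (a + v)).comp_const_add a v
    have e2 := (hG (a - v)).comp_const_sub a v
    have e3 := ((hasDerivAt_pow 2 v).const_mul c)
    refine (((e1.add e2).sub_const (2 * G a)).sub e3).congr_deriv ?_
    simp
    ring
  have hbound : ∀ v ∈ Metric.closedBall (0 : ℝ) |u|,
      ‖G' (a + v) - G' (a - v) - 2 * c * v‖ ≤ ε * |u| := by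
    intro v hv
    have hv' : |v| ≤ |u| := by simpa using hv
    have b1 := H (y := a + v) (by simpa using hv'.trans_lt hu)
    have b2 := H (y := a - v) (by simpa using hv'.trans_lt hu)
    simp only [add_sub_cancel_left, sub_sub_cancel_left, smul_eq_mul, Real.norm_eq_abs,
      abs_neg] at b1 b2 ⊢
    have : G' (a + v) - G' (a - v) - 2 * c * v =
      (G' (a + v) - G' a - v * c) - (G' (a - v) - G' a - -v * c) := by ring
    have e : |a - v - a| = |v| := by rw [show a - v - a = -v by ring, abs_neg]
    rw [this]
    refine (abs_sub _ _).trans ?_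
    nlinarith [abs_nonneg v]
  have := (convex_closedBall (0 : ℝ) |u|).norm_image_sub_le_of_norm_hasDerivWithin_le
    (fun v _ => (hP v).hasDerivWithinAt) hbound (x := 0) (y := u) (by simp) (by simp)
  have hP0 : P 0 = 0 := by simp [P]; ring
  rw [hP0, sub_zero, sub_zero, Real.norm_eq_abs, Real.norm_eq_abs, mul_assoc, ← abs_mul,
    abs_of_nonneg (mul_self_nonneg u), ← sq] at this
  exact this

theorem square_mem_of_affine_invariant {V : Submodule ℝ C(ℝ, ℝ)} (hV : IsClosed (V : Set C(ℝ, ℝ)))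
    (haff : ∀ f ∈ V, ∀ a b, f.compAffine a b ∈ V) {σ : C(ℝ, ℝ)} (hσ : σ ∈ V)
    (hnonaff : ¬ ∃ a b : ℝ, ⇑σ = fun x => a * x + b) (hone : (1 : C(ℝ, ℝ)) ∈ V) :
    (⟨fun x => x ^ 2, by fun_prop⟩ : C(ℝ, ℝ)) ∈ V := by
  obtain ⟨a, h, hh, hc⟩ : ∃ a h : ℝ, 0 < h ∧
      σ (a + h + h) - σ (a + h) - (σ (a + h) - σ a) ≠ 0 := by
    by_contra! H
    exact hnonaff (affine_of_second_difference_eq_zero σ.continuous H)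
  set c := σ (a + h + h) - σ (a + h) - (σ (a + h) - σ a)
  let G := (σ.slidingIntegral h).slidingIntegral h
  have hGV : G ∈ V := ContinuousMap.slidingIntegral_mem hV haff
    (ContinuousMap.slidingIntegral_mem hV haff hσ hh) hh
  have hG := (σ.slidingIntegral h).hasDerivAt_slidingIntegral h
  have hG' : HasDerivAt (fun x => σ.slidingIntegral h (x + h) - σ.slidingIntegral h x) c a :=
    ((σ.hasDerivAt_slidingIntegral h (a + h)).comp_add_const a h).sub
      (σ.hasDerivAt_slidingIntegral h a)
  rw [← SetLike.mem_coe, ← hV.closure_eq, ContinuousMap.mem_closure_iff_dist]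
  intro K hK ε hε
  obtain ⟨R, hR0, hR⟩ := hK.isBounded.exists_pos_norm_le
  obtain ⟨δ, hδ, H⟩ := exists_abs_symmetric_second_difference_le hG hG'
    (ε := |c| * ε / (2 * R ^ 2)) (by positivity)
  let t := δ / (2 * R)
  have ht : 0 < t := by positivity
  refine ⟨(c * t ^ 2)⁻¹ • (G.compAffine t a + G.compAffine (-t) a - (2 * G a) • 1),
    V.smul_mem _ (V.sub_mem (V.add_mem (haff _ hGV _ _) (haff _ hGV _ _)) (V.smul_mem _ hone)),
    fun x hx => ?_⟩
  have hxR : |x| ≤ R := hR x hx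
  have htx : |t * x| < δ := by
    rw [abs_mul, abs_of_pos ht]
    calc t * |x| ≤ t * R := by gcongr
      _ = δ / 2 := by simp only [t]; field_simp
      _ < δ := by linarith
  have hb := H (t * x) htx
  have hx2 : x ^ 2 ≤ R ^ 2 := sq_le_sq' (by linarith [neg_abs_le x]) (by linarith [le_abs_self x])
  rw [Real.dist_eq]
  have e : ((c * t ^ 2)⁻¹ • (G.compAffine t a + G.compAffine (-t) a - (2 * G a) • 1)) x - x ^ 2 =
      (c * t ^ 2)⁻¹ * (G (a + t * x) + G (a - t * x) - 2 * G a - c * (t * x) ^ 2) := by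
    simp only [ContinuousMap.smul_apply, ContinuousMap.sub_apply, ContinuousMap.add_apply,
      ContinuousMap.compAffine, ContinuousMap.coe_mk, smul_eq_mul, ContinuousMap.one_apply, mul_one]
    rw [add_comm (t * x) a, show -t * x + a = a - t * x by ring]
    field_simp
  have hc' : 0 < |c| := abs_pos.2 hc
  change |((c * t ^ 2)⁻¹ • (G.compAffine t a + G.compAffine (-t) a - (2 * G a) • 1)) x - x ^ 2| < ε
  rw [e, abs_mul, abs_inv, abs_mul, abs_of_pos (pow_pos ht 2)]
  calc _ ≤ (|c| * t ^ 2)⁻¹ * (|c| * ε / (2 * R ^ 2) * (t * x) ^ 2) := by gcongr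
    _ = ε / 2 * (x ^ 2 / R ^ 2) := by field_simp
    _ ≤ ε / 2 * 1 := by gcongr; exact div_le_one_of_le₀ hx2 (by positivity)
    _ < ε := by linarith

section Networks

variable {σ : ℝ → ℝ}

theorem IsNetwork.comp_affine {m k n : ℕ} {g : (Fin k → ℝ) → (Fin n → ℝ)} (hg : IsNetwork σ g)
    (A : Matrix (Fin k) (Fin m) ℝ) (b : Fin k → ℝ) :
    IsNetwork σ (fun x => g (A.mulVec x + b)) := by
  cases hg with
  | affine A' b' =>
    simpa [Matrix.mulVec_add, add_assoc] using
      IsNetwork.affine (σ := σ) (A' * A) (A'.mulVec b + b')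
  | comp A' b' g' hg' =>
    simpa [Matrix.mulVec_add, add_assoc] using
      IsNetwork.comp (σ := σ) (A' * A) (A'.mulVec b + b') g' hg'

theorem IsNetwork.comp_network {m k n : ℕ} {f : (Fin m → ℝ) → (Fin k → ℝ)}
    {g : (Fin k → ℝ) → (Fin n → ℝ)} (hg : IsNetwork σ g) (hf : IsNetwork σ f) :
    IsNetwork σ (fun x => g (f x)) := by
  induction hf with
  | affine A b => exact hg.comp_affine A b
  | comp A b f' _ ih => exact IsNetwork.comp A b _ (ih hg)

/-- The locally uniform limits of networks. -/
def networkClosure (σ : ℝ → ℝ) (m n : ℕ) : Set C(Fin m → ℝ, Fin n → ℝ) :=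
  closure {f | IsNetwork σ f}

theorem comp_mem_networkClosure {m k n : ℕ} {f : C(Fin m → ℝ, Fin k → ℝ)}
    {g : C(Fin k → ℝ, Fin n → ℝ)} (hg : g ∈ networkClosure σ k n)
    (hf : f ∈ networkClosure σ m k) : g.comp f ∈ networkClosure σ m n :=
  map_mem_closure₂ (f := fun (f : C(Fin m → ℝ, Fin k → ℝ)) (g : C(Fin k → ℝ, Fin n → ℝ)) =>
    g.comp f) ContinuousMap.continuous_comp' hf hg fun a ha b hb =>
      IsNetwork.comp_network (f := a) (g := b) hb ha

/-- The affine map `x ↦ A x + b` as a continuous map. -/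
def affineMap {m n : ℕ} (A : Matrix (Fin n) (Fin m) ℝ) (b : Fin n → ℝ) :
    C(Fin m → ℝ, Fin n → ℝ) := ⟨fun x => A.mulVec x + b, by fun_prop⟩

theorem affineMap_mem_networkClosure {m n : ℕ} (A : Matrix (Fin n) (Fin m) ℝ) (b : Fin n → ℝ) :
    affineMap A b ∈ networkClosure σ m n := subset_closure (IsNetwork.affine A b)

/-- Networks with a single hidden layer. -/
def shallowNetworks (σ : ℝ → ℝ) (m n : ℕ) : Submodule ℝ C(Fin m → ℝ, Fin n → ℝ) where
  carrier := {f | ∃ (k : ℕ) (B : Fin k → Fin m → ℝ) (c : Fin k → ℝ) (A : Fin k → Fin n → ℝ)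
    (d : Fin n → ℝ), ∀ x, f x = ∑ i, σ (B i ⬝ᵥ x + c i) • A i + d}
  zero_mem' := ⟨0, 0, 0, 0, 0, by simp⟩
  add_mem' := by
    rintro f g ⟨k, B, c, A, d, hf⟩ ⟨k', B', c', A', d', hg⟩
    refine ⟨k + k', Fin.append B B', Fin.append c c', Fin.append A A', d + d', fun x => ?_⟩
    simp only [ContinuousMap.add_apply, hf, hg, Fin.sum_univ_add, Fin.append_left,
      Fin.append_right]
    abel
  smul_mem' := by
    rintro r f ⟨k, B, c, A, d, hf⟩
    refine ⟨k, B, c, r • A, r • d, fun x => ?_⟩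
    simp only [ContinuousMap.smul_apply, hf, smul_add, Finset.smul_sum, Pi.smul_apply,
      smul_comm r]

theorem topologicalClosure_shallowNetworks_le {m n : ℕ} :
    ((shallowNetworks σ m n).topologicalClosure : Set C(Fin m → ℝ, Fin n → ℝ)) ⊆
      networkClosure σ m n := by
  refine closure_mono ?_
  rintro f ⟨k, B, c, A, d, hf⟩
  have h := IsNetwork.comp (σ := σ) (Matrix.of B) c _ (IsNetwork.affine (Matrix.of A).transpose d)
  have e : ⇑f = fun x => (Matrix.of A).transpose.mulVec
      (fun i => σ ((Matrix.of B).mulVec x i + c i)) + d := by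
    ext x j
    simp [hf, Matrix.mulVec, dotProduct, mul_comm]
  rw [Set.mem_ofPred_eq, e]
  exact h

/-- The ridge function `x ↦ h (w ⬝ᵥ x + b) • v`, linear in the profile `h`. -/
def ridge {m n : ℕ} (w : Fin m → ℝ) (b : ℝ) (v : Fin n → ℝ) :
    C(ℝ, ℝ) →ₗ[ℝ] C(Fin m → ℝ, Fin n → ℝ) where
  toFun h := ⟨fun x => h (w ⬝ᵥ x + b) • v, by fun_prop⟩
  map_add' _ _ := by ext; simp [add_mul]
  map_smul' _ _ := by ext; simp [mul_assoc]

theorem continuous_ridge {m n : ℕ} (w : Fin m → ℝ) (b : ℝ) (v : Fin n → ℝ) :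
    Continuous (ridge w b v) := by
  let φ : C(Fin m → ℝ, ℝ) := ⟨fun x => w ⬝ᵥ x + b, by fun_prop⟩
  let ψ : C(ℝ, Fin n → ℝ) := ⟨fun t => t • v, by fun_prop⟩
  exact (ContinuousMap.continuous_postcomp ψ).comp (ContinuousMap.continuous_precomp φ)

/-- Profiles all of whose ridge functions are limits of single hidden layer networks. -/
def ridgeProfiles (σ : ℝ → ℝ) : Submodule ℝ C(ℝ, ℝ) :=
  ⨅ (m : ℕ) (n : ℕ) (w : Fin m → ℝ) (b : ℝ) (v : Fin n → ℝ),
    (shallowNetworks σ m n).topologicalClosure.comap (ridge w b v)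

theorem mem_ridgeProfiles {h : C(ℝ, ℝ)} : h ∈ ridgeProfiles σ ↔
    ∀ (m n : ℕ) (w : Fin m → ℝ) (b : ℝ) (v : Fin n → ℝ),
      ridge w b v h ∈ (shallowNetworks σ m n).topologicalClosure := by
  simp [ridgeProfiles, Submodule.mem_iInf]

theorem isClosed_ridgeProfiles : IsClosed (ridgeProfiles σ : Set C(ℝ, ℝ)) := by
  simp only [ridgeProfiles, Submodule.coe_iInf, Submodule.comap_coe]
  refine isClosed_iInter fun m => isClosed_iInter fun n => isClosed_iInter fun w =>
    isClosed_iInter fun b => isClosed_iInter fun v => ?_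
  exact (Submodule.isClosed_topologicalClosure _).preimage (continuous_ridge w b v)

theorem compAffine_mem_ridgeProfiles {f : C(ℝ, ℝ)} (hf : f ∈ ridgeProfiles σ) (a b : ℝ) :
    f.compAffine a b ∈ ridgeProfiles σ := by
  rw [mem_ridgeProfiles] at hf ⊢
  intro m n w c v
  convert hf m n (a • w) (a * c + b) v using 1
  ext x
  simp [ridge, ContinuousMap.compAffine, mul_add, add_assoc]

theorem one_mem_ridgeProfiles : (1 : C(ℝ, ℝ)) ∈ ridgeProfiles σ := by
  refine mem_ridgeProfiles.2 fun m n w b v => Submodule.le_topologicalClosure _ ?_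
  exact ⟨0, 0, 0, 0, v, fun x => by simp [ridge]⟩

theorem activation_mem_ridgeProfiles (hσ : Continuous σ) :
    (⟨σ, hσ⟩ : C(ℝ, ℝ)) ∈ ridgeProfiles σ := by
  refine mem_ridgeProfiles.2 fun m n w b v => Submodule.le_topologicalClosure _ ?_
  exact ⟨1, fun _ => w, fun _ => b, fun _ => v, 0, fun x => by simp [ridge]⟩

theorem square_mem_ridgeProfiles (hσ : Continuous σ)
    (hnonaff : ¬ ∃ a b : ℝ, σ = fun x => a * x + b) :
    (⟨fun x => x ^ 2, by fun_prop⟩ : C(ℝ, ℝ)) ∈ ridgeProfiles σ :=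
  square_mem_of_affine_invariant isClosed_ridgeProfiles
    (fun _ hf a b => compAffine_mem_ridgeProfiles hf a b) (activation_mem_ridgeProfiles hσ)
    hnonaff one_mem_ridgeProfiles

theorem linear_mem_ridgeProfiles (hσ : Continuous σ)
    (hnonaff : ¬ ∃ a b : ℝ, σ = fun x => a * x + b) :
    ContinuousMap.id ℝ ∈ ridgeProfiles σ := by
  have hsq := square_mem_ridgeProfiles hσ hnonaff
  have := (ridgeProfiles σ).smul_mem (1 / 2 : ℝ) <|
    (ridgeProfiles σ).sub_mem ((ridgeProfiles σ).sub_mem (compAffine_mem_ridgeProfiles hsq 1 1) hsq)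
      one_mem_ridgeProfiles
  convert this using 1
  ext x
  simp [ContinuousMap.compAffine]
  ring

/-- The map `y ↦ ((w ⬝ᵥ y + d) * (w' ⬝ᵥ y + d'), y)`. -/
def adjoinProduct {p : ℕ} (w w' : Fin p → ℝ) (d d' : ℝ) : C(Fin p → ℝ, Fin (p + 1) → ℝ) :=
  ⟨fun y => Fin.cons ((w ⬝ᵥ y + d) * (w' ⬝ᵥ y + d')) y, by fun_prop⟩

theorem adjoinProduct_mem_networkClosure (hσ : Continuous σ)
    (hnonaff : ¬ ∃ a b : ℝ, σ = fun x => a * x + b) {p : ℕ} (w w' : Fin p → ℝ) (d d' : ℝ) :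
    adjoinProduct w w' d d' ∈ networkClosure σ p (p + 1) := by
  apply topologicalClosure_shallowNetworks_le
  have hsq := mem_ridgeProfiles.1 (square_mem_ridgeProfiles hσ hnonaff) p (p + 1)
  have hid := mem_ridgeProfiles.1 (linear_mem_ridgeProfiles hσ hnonaff) p (p + 1)
  set S := (shallowNetworks σ p (p + 1)).topologicalClosure
  have key := S.add_mem
    (S.smul_mem (1 / 4 : ℝ) <| S.sub_mem (hsq (w + w') (d + d') (Pi.single 0 1))
      (hsq (w - w') (d - d') (Pi.single 0 1)))
    (S.sum_mem (t := Finset.univ) fun i _ => hid (Pi.single i 1) 0 (Pi.single (Fin.succ i) 1))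
  refine (congrArg (· ∈ S) ?_).mp key
  symm
  ext y j
  refine Fin.cases ?_ (fun j => ?_) j
  · simp [adjoinProduct, ridge, Finset.sum_apply]
    ring
  · simp [adjoinProduct, ridge, Finset.sum_apply, Pi.single_apply]

/-- The affine functions of the components of `G`. -/
def affineReadouts {m p : ℕ} (G : C(Fin m → ℝ, Fin p → ℝ)) : Submodule ℝ C(Fin m → ℝ, ℝ) where
  carrier := {f | ∃ (w : Fin p → ℝ) (d : ℝ), ∀ x, f x = w ⬝ᵥ G x + d}
  zero_mem' := ⟨0, 0, by simp⟩
  add_mem' := by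
    rintro f g ⟨w, d, hf⟩ ⟨w', d', hg⟩
    exact ⟨w + w', d + d', fun x => by simp [hf, hg]; ring⟩
  smul_mem' := by
    rintro r f ⟨w, d, hf⟩
    exact ⟨r • w, r * d, fun x => by simp [hf]; ring⟩

/-- Functions that can be adjoined to the components of every limit of networks from which the
input is recovered affinely. -/
def adjoinable (σ : ℝ → ℝ) (m : ℕ) : Set C(Fin m → ℝ, ℝ) :=
  {f | ∀ (p : ℕ), ∀ G ∈ networkClosure σ m p,
    affineReadouts (ContinuousMap.id (Fin m → ℝ)) ≤ affineReadouts G →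
    ∃ (q : ℕ), ∃ G' ∈ networkClosure σ m q,
      affineReadouts G ≤ affineReadouts G' ∧ f ∈ affineReadouts G'}

theorem exists_mul_mem_affineReadouts (hσ : Continuous σ)
    (hnonaff : ¬ ∃ a b : ℝ, σ = fun x => a * x + b) {m p : ℕ} {G : C(Fin m → ℝ, Fin p → ℝ)}
    (hG : G ∈ networkClosure σ m p) {f g : C(Fin m → ℝ, ℝ)} (hf : f ∈ affineReadouts G)
    (hg : g ∈ affineReadouts G) : ∃ G' ∈ networkClosure σ m (p + 1),
      affineReadouts G ≤ affineReadouts G' ∧ f * g ∈ affineReadouts G' := by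
  obtain ⟨w, d, hf⟩ := hf
  obtain ⟨w', d', hg⟩ := hg
  refine ⟨_, comp_mem_networkClosure (adjoinProduct_mem_networkClosure hσ hnonaff w w' d d') hG,
    ?_, ?_⟩
  · rintro u ⟨v, e, hu⟩
    refine ⟨Fin.cons 0 v, e, fun x => ?_⟩
    simp [hu, adjoinProduct, dotProduct, Fin.sum_univ_succ]
  · refine ⟨Fin.cons 1 0, 0, fun x => ?_⟩
    simp [hf, hg, adjoinProduct, dotProduct, Fin.sum_univ_succ]

theorem const_mem_affineReadouts {m p : ℕ} (G : C(Fin m → ℝ, Fin p → ℝ)) (r : ℝ) :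
    ContinuousMap.const _ r ∈ affineReadouts G := ⟨0, r, by simp⟩

/-- The adjoinable functions form a subalgebra when the activation is continuous and not affine. -/
def adjoinableSubalgebra (hσ : Continuous σ) (hnonaff : ¬ ∃ a b : ℝ, σ = fun x => a * x + b)
    (m : ℕ) : Subalgebra ℝ C(Fin m → ℝ, ℝ) where
  carrier := adjoinable σ m
  mul_mem' := by
    intro f g hf hg p G hG hid
    obtain ⟨q, G₁, hG₁, hle₁, hf₁⟩ := hf p G hG hid
    obtain ⟨r, G₂, hG₂, hle₂, hg₂⟩ := hg q G₁ hG₁ (hid.trans hle₁)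
    obtain ⟨G₃, hG₃, hle₃, hfg⟩ := exists_mul_mem_affineReadouts hσ hnonaff hG₂ (hle₂ hf₁) hg₂
    exact ⟨_, G₃, hG₃, (hle₁.trans hle₂).trans hle₃, hfg⟩
  add_mem' := by
    intro f g hf hg p G hG hid
    obtain ⟨q, G₁, hG₁, hle₁, hf₁⟩ := hf p G hG hid
    obtain ⟨r, G₂, hG₂, hle₂, hg₂⟩ := hg q G₁ hG₁ (hid.trans hle₁)
    exact ⟨_, G₂, hG₂, hle₁.trans hle₂, Submodule.add_mem _ (hle₂ hf₁) hg₂⟩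
  algebraMap_mem' := fun r p G hG _ => ⟨p, G, hG, le_rfl, const_mem_affineReadouts G r⟩

theorem separatesPoints_adjoinableSubalgebra (hσ : Continuous σ)
    (hnonaff : ¬ ∃ a b : ℝ, σ = fun x => a * x + b) (m : ℕ) :
    (adjoinableSubalgebra hσ hnonaff m).SeparatesPoints := by
  intro x y hxy
  obtain ⟨i, hi⟩ := Function.ne_iff.1 hxy
  let f : C(Fin m → ℝ, ℝ) := ⟨fun x => x i, by fun_prop⟩
  refine ⟨f, ⟨f, fun p G hG hid => ⟨p, G, hG, le_rfl, hid ⟨Pi.single i 1, 0, ?_⟩⟩, rfl⟩, hi⟩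
  intro z
  simp [f]

theorem exists_affineReadouts_of_adjoinable {m n : ℕ} (f : Fin n → C(Fin m → ℝ, ℝ))
    (hf : ∀ j, f j ∈ adjoinable σ m) :
    ∃ (p : ℕ), ∃ G ∈ networkClosure σ m p, ∀ j, f j ∈ affineReadouts G := by
  suffices ∀ s : Finset (Fin n), ∃ (p : ℕ), ∃ G ∈ networkClosure σ m p,
      affineReadouts (ContinuousMap.id (Fin m → ℝ)) ≤ affineReadouts G ∧
        ∀ j ∈ s, f j ∈ affineReadouts G by
    obtain ⟨p, G, hG, -, h⟩ := this Finset.univ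
    exact ⟨p, G, hG, fun j => h j (Finset.mem_univ j)⟩
  intro s
  induction s using Finset.induction_on with
  | empty =>
    refine ⟨m, affineMap 1 0, affineMap_mem_networkClosure _ _, le_of_eq ?_, by simp⟩
    congr 1
    ext
    simp [affineMap]
  | insert j s _ ih =>
    obtain ⟨p, G, hG, hid, h⟩ := ih
    obtain ⟨q, G', hG', hle, hj⟩ := hf j p G hG hid
    refine ⟨q, G', hG', hid.trans hle, fun i hi => ?_⟩
    rcases Finset.mem_insert.1 hi with rfl | hi
    exacts [hj, hle (h i hi)]

theorem pi_mem_networkClosure {m n : ℕ} (f : Fin n → C(Fin m → ℝ, ℝ))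
    (hf : ∀ j, f j ∈ adjoinable σ m) : ContinuousMap.pi f ∈ networkClosure σ m n := by
  obtain ⟨p, G, hG, h⟩ := exists_affineReadouts_of_adjoinable f hf
  choose w d hw using h
  convert comp_mem_networkClosure (affineMap_mem_networkClosure (Matrix.of w) d) hG using 1
  ext x j
  simp [affineMap, hw, Matrix.mulVec]

/-- **Universal approximation theorem** for deep networks with a continuous non-affine
activation. -/
theorem networkClosure_eq_univ (hσ : Continuous σ)
    (hnonaff : ¬ ∃ a b : ℝ, σ = fun x => a * x + b) (m n : ℕ) :
    networkClosure σ m n = Set.univ := by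
  refine Set.eq_univ_of_forall fun f => ?_
  rw [networkClosure, ← closure_closure, ContinuousMap.mem_closure_iff_dist]
  intro K hK ε hε
  have h (j : Fin n) :=
    ContinuousMap.exists_mem_subalgebra_near_continuous_of_isCompact_of_separatesPoints
      (separatesPoints_adjoinableSubalgebra hσ hnonaff m)
      ⟨fun x => f x j, by fun_prop⟩ hK hε
  choose g hg hgf using h
  refine ⟨_, pi_mem_networkClosure g hg, fun x hx => (dist_pi_lt_iff hε).2 fun j => ?_⟩
  exact hgf j x hx

end Networks

section Iteration

variable {σ : ℝ → ℝ}

theorem forall_lt_or_forall_gt_of_forall_ne (hσ : Continuous σ) (hfix : ∀ x, σ x ≠ x) :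
    (∀ x, x < σ x) ∨ (∀ x, σ x < x) := by
  by_contra! h
  obtain ⟨⟨x, hx⟩, y, hy⟩ := h
  obtain ⟨z, hz⟩ := mem_range_of_exists_le_of_exists_ge (hσ.sub continuous_id)
    (c := 0) ⟨x, by simpa using hx⟩ ⟨y, by simpa using hy⟩
  exact hfix z (by simpa [sub_eq_zero] using hz)

theorem strictMono_of_injective_of_forall_ne (hσ : Continuous σ) (hinj : Function.Injective σ)
    (hfix : ∀ x, σ x ≠ x) : StrictMono σ := by
  refine (hσ.strictMono_of_inj hinj).resolve_right fun hanti => ?_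
  rcases forall_lt_or_forall_gt_of_forall_ne hσ hfix with h | h
  · exact (h (σ 0)).not_gt (hanti (h 0))
  · exact (h (σ 0)).not_gt (hanti (h 0))

theorem exists_iterate_abs_gt_of_lt (hσ : Continuous σ) (hmono : StrictMono σ)
    (h : ∀ x, x < σ x) (R M : ℝ) : ∃ k : ℕ, ∀ x, |x| ≤ R → M < |σ^[k] x| := by
  have hm : Monotone fun k => σ^[k] (-R) :=
    monotone_nat_of_le_succ fun k => by
      rw [Function.iterate_succ_apply']
      exact (h _).le
  rcases tendsto_atTop_of_monotone hm with ht | ⟨l, hl⟩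
  · obtain ⟨k, hk⟩ := (ht.eventually_gt_atTop M).exists
    exact ⟨k, fun x hx => hk.trans_le <|
      (hmono.monotone.iterate k (abs_le.1 hx).1).trans (le_abs_self _)⟩
  · exact absurd (isFixedPt_of_tendsto_iterate hl hσ.continuousAt) (h l).ne'

theorem exists_iterate_abs_gt (hσ : Continuous σ) (hinj : Function.Injective σ)
    (hfix : ∀ x, σ x ≠ x) (R M : ℝ) : ∃ k : ℕ, ∀ x, |x| ≤ R → M < |σ^[k] x| := by
  have hmono := strictMono_of_injective_of_forall_ne hσ hinj hfix
  rcases forall_lt_or_forall_gt_of_forall_ne hσ hfix with h | h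
  · exact exists_iterate_abs_gt_of_lt hσ hmono h R M
  · obtain ⟨k, hk⟩ := exists_iterate_abs_gt_of_lt (σ := fun x => -σ (-x)) (by fun_prop)
      (fun x y hxy => neg_lt_neg (hmono (neg_lt_neg hxy)))
      (fun x => by linarith [h (-x)]) R M
    refine ⟨k, fun x hx => ?_⟩
    have hs : Function.Semiconj (fun x : ℝ => -x) σ (fun x => -σ (-x)) := fun x => by simp
    have := hk (-x) (by rwa [abs_neg])
    rwa [← (hs.iterate_right k) x, abs_neg] at this

theorem headNet_one_zero {m : ℕ} (k : ℕ) (x : Fin m → ℝ) (i : Fin m) :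
    headNet σ (fun _ => 1) (fun _ => 0) k x i = σ^[k] (x i) := by
  induction k with
  | zero => rfl
  | succ k ih => simp [headNet, ih, Function.iterate_succ_apply']

end Iteration

theorem eNorm_le_of_norm_le {n : ℕ} {y : Fin n → ℝ} {r : ℝ} (hy : ‖y‖ ≤ r) :
    eNorm y ≤ n * r := by
  have hr : 0 ≤ r := (norm_nonneg y).trans hy
  have hyr (i : Fin n) : |y i| ≤ r := (norm_le_pi_norm y i).trans hy
  refine Real.sqrt_le_iff.2 ⟨by positivity, ?_⟩
  calc ∑ i, y i ^ 2 ≤ ∑ _i : Fin n, r ^ 2 :=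
        Finset.sum_le_sum fun i _ => sq_le_sq' (abs_le.1 (hyr i)).1 (abs_le.1 (hyr i)).2
    _ = n * r ^ 2 := by simp
    _ ≤ (n * r) ^ 2 := by
        rw [mul_pow]
        gcongr
        exact_mod_cast Nat.le_self_pow two_ne_zero n

theorem ducc_le_of_eNorm_le {m n : ℕ} {f g : (Fin m → ℝ) → (Fin n → ℝ)} {R : ℕ} {δ : ℝ}
    (hδ : 0 ≤ δ) (h : ∀ x, (∀ i, |x i| ≤ (R : ℝ)) → eNorm (f x - g x) ≤ δ) :
    ducc f g ≤ δ + 3 * (2 / 3) ^ R := by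
  set T : ℕ → ℝ := fun k => if sK (k + 1) f g = ⊤ then 1
     else (sK (k + 1) f g).toReal / (1 + (sK (k + 1) f g).toReal) with hT
  have hT0 (k : ℕ) : 0 ≤ T k := by
    simp only [hT]; split_ifs <;> positivity
  have hT1 (k : ℕ) : T k ≤ 1 := by
    simp only [hT]; split_ifs
    · exact le_rfl
    · exact div_le_one_of_le₀ (by linarith) (by positivity)
  have hTδ (k : ℕ) (hk : k + 1 ≤ R) : T k ≤ δ := by
    have hs : sK (k + 1) f g ≤ ENNReal.ofReal δ := by
      refine iSup₂_le fun x hx => ENNReal.ofReal_le_ofReal (h x fun i => (hx i).trans ?_)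
      exact_mod_cast hk
    have hr : (sK (k + 1) f g).toReal ≤ δ := ENNReal.toReal_le_of_le_ofReal hδ hs
    simp only [hT]
    rw [if_neg (hs.trans_lt ENNReal.ofReal_lt_top).ne]
    exact (div_le_self ENNReal.toReal_nonneg (by simp)).trans hr
  have hterm (k : ℕ) : (1 / 2 : ℝ) ^ (k + 1) * T k ≤
      (1 / 2 : ℝ) ^ k * (1 / 2 * δ) + (3 / 4 : ℝ) ^ k * (3 / 4 * (2 / 3) ^ R) := by
    rcases le_or_gt (k + 1) R with hk | hk
    · have h1 := mul_le_mul_of_nonneg_left (hTδ k hk) (by positivity : (0 : ℝ) ≤ (1 / 2) ^ (k + 1))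
      have h2 : (0 : ℝ) ≤ (3 / 4 : ℝ) ^ k * (3 / 4 * (2 / 3) ^ R) := by positivity
      rw [pow_succ] at h1 ⊢
      linarith
    · have h1 := mul_le_mul_of_nonneg_left (hT1 k) (by positivity : (0 : ℝ) ≤ (1 / 2) ^ (k + 1))
      have h2 : (2 / 3 : ℝ) ^ (k + 1) ≤ (2 / 3) ^ R :=
        pow_le_pow_of_le_one (by norm_num) (by norm_num) hk.le
      have h3 : (1 / 2 : ℝ) ^ (k + 1) = (3 / 4 : ℝ) ^ (k + 1) * (2 / 3) ^ (k + 1) := by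
        rw [← mul_pow]; norm_num
      have h4 := mul_le_mul_of_nonneg_left h2 (by positivity : (0 : ℝ) ≤ (3 / 4) ^ (k + 1))
      have h5 : (0 : ℝ) ≤ (1 / 2 : ℝ) ^ k * (1 / 2 * δ) := by positivity
      have h6 : (3 / 4 : ℝ) ^ (k + 1) * (2 / 3) ^ R = (3 / 4 : ℝ) ^ k * (3 / 4 * (2 / 3) ^ R) := by
        ring
      linarith
  have hS := ((hasSum_geometric_of_lt_one (r := (1 / 2 : ℝ)) (by norm_num)
    (by norm_num)).mul_right (1 / 2 * δ)).add ((hasSum_geometric_of_lt_one (r := (3 / 4 : ℝ))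
    (by norm_num) (by norm_num)).mul_right (3 / 4 * (2 / 3) ^ R))
  have hsum : Summable fun k => (1 / 2 : ℝ) ^ (k + 1) * T k :=
    Summable.of_nonneg_of_le (fun k => mul_nonneg (by positivity) (hT0 k)) hterm hS.summable
  refine (hasSum_le hterm hsum.hasSum hS).trans (le_of_eq ?_)
  norm_num
  ring

theorem exists_extension_of_disjoint.{u} {X : Type u} {Y E : Type*} [TopologicalSpace X]
    [NormalSpace X] [T2Space X] [TopologicalSpace Y] [CompactSpace Y] [TopologicalSpace E] [AddCommGroup E]
    [Module ℝ E] [IsTopologicalAddGroup E] [ContinuousSMul ℝ E] [TietzeExtension.{u} E]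
    {φ : C(Y, X)} (hφ : Function.Injective φ) {K : Set X} (hK : IsClosed K)
    (hdisj : Disjoint K (Set.range φ)) (f : C(Y, E)) (f₀ : C(X, E)) :
    ∃ g : C(X, E), (∀ y, g (φ y) = f y) ∧ ∀ x ∈ K, g x = f₀ x := by
  have he : IsClosedEmbedding φ := φ.continuous.isClosedEmbedding hφ
  obtain ⟨f₁, hf₁⟩ := f.exists_extension' he
  obtain ⟨χ, hχ0, hχ1, -⟩ := exists_continuous_zero_one_of_isClosed hK he.isClosed_range hdisj
  refine ⟨⟨fun x => f₀ x + χ x • (f₁ x - f₀ x), by fun_prop⟩, fun y => ?_, fun x hx => ?_⟩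
  · simp [hχ1 (Set.mem_range_self y), ← hf₁]
  · simp [hχ0 hx]

/-- feed-forward networks with constrained final layers are universal.
Given finitely many continuous constraints `F i` with thresholds `C i`, compatible at
some `f₀`, every continuous `f` can be `ε`-approximated by `f₂ ∘ f₁` where `f₂` is a
feed-forward network satisfying all constraints strictly and `f₁` is a stack of layers
`σ•(Aⱼ· + bⱼ)` with diagonal matrices `Aⱼ`. -/
theorem stmt_14 {m n : ℕ} (hm : 0 < m) (hn : 0 < n)
    (σ : ℝ → ℝ) (hσ : Continuous σ)
    (hnonaff : ¬ ∃ a b : ℝ, σ = fun x => a * x + b)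
    (hinj : Function.Injective σ) (hfix : ∀ x : ℝ, σ x ≠ x)
    (hdiff : ∃ x₀ d : ℝ, d ≠ 0 ∧ HasDerivAt σ d x₀)
    (N : ℕ) (F : Fin N → C((Fin m → ℝ), (Fin n → ℝ)) → ℝ)
    (hFcont : ∀ i, Continuous (F i))
    (hFpos : ∀ i f, 0 ≤ F i f)
    (C : Fin N → ℝ) (hC : ∀ i, 0 < C i)
    (f₀ : C((Fin m → ℝ), (Fin n → ℝ))) (hf₀ : ∀ i, F i f₀ < C i)
    (f : C((Fin m → ℝ), (Fin n → ℝ))) (ε : ℝ) (hε : 0 < ε) :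
    ∃ (k : ℕ) (A : ℕ → Matrix (Fin m) (Fin m) ℝ) (b : ℕ → (Fin m → ℝ))
      (f₂ : C((Fin m → ℝ), (Fin n → ℝ))),
      IsNetwork σ ⇑f₂ ∧
      (∀ j < k, ∀ p q : Fin m, p ≠ q → A j p q = 0) ∧
      ducc ⇑f (fun x => f₂ (headNet σ A b k x)) < ε ∧
      (∀ i, F i f₂ < C i) := by
  have hU : IsOpen {g : C((Fin m → ℝ), (Fin n → ℝ)) | ∀ i, F i g < C i} := by
    simp only [Set.ofPred_forall]
    exact isOpen_iInter_of_finite fun i => isOpen_lt (hFcont i) continuous_const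
  obtain ⟨⟨K, δ₀⟩, ⟨hK, hδ₀⟩, hKU⟩ :=
    (ContinuousMap.hasBasis_nhds_dist f₀).mem_iff.1 (hU.mem_nhds hf₀)
  obtain ⟨M, hM⟩ := hK.isBounded.exists_norm_le
  obtain ⟨R, hR⟩ := exists_pow_lt_of_lt_one (show 0 < ε / 6 by positivity)
    (show (2 / 3 : ℝ) < 1 by norm_num)
  obtain ⟨k, hk⟩ := exists_iterate_abs_gt hσ hinj hfix R M
  let Q : Set (Fin m → ℝ) := Metric.closedBall 0 R
  have hQ : IsCompact Q := isCompact_closedBall 0 (R : ℝ)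
  have : CompactSpace Q := isCompact_iff_compactSpace.1 hQ
  have hkc : Continuous σ^[k] := hσ.iterate k
  let Φ : C(Fin m → ℝ, Fin m → ℝ) := ⟨fun x i => σ^[k] (x i), by fun_prop⟩
  have hΦ : Function.Injective (Φ.restrict Q) := fun x y hxy =>
    Subtype.ext <| funext fun i => (hinj.iterate k) (congrFun hxy i)
  have hdisj : Disjoint K (Set.range (Φ.restrict Q)) := by
    rw [Set.disjoint_right]
    rintro _ ⟨x, rfl⟩ hx
    have hxR : |x.1 ⟨0, hm⟩| ≤ R :=
      (norm_le_pi_norm x.1 ⟨0, hm⟩).trans (mem_closedBall_zero_iff.1 x.2)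
    exact ((hk _ hxR).trans_le (norm_le_pi_norm (Φ x.1) ⟨0, hm⟩)).not_ge (hM _ hx)
  obtain ⟨g, hgQ, hgK⟩ := exists_extension_of_disjoint hΦ hK.isClosed hdisj (f.restrict Q) f₀
  have hn' : (0 : ℝ) < n := by exact_mod_cast hn
  have hg : g ∈ networkClosure σ m n := by
    rw [networkClosure_eq_univ hσ hnonaff]
    trivial
  obtain ⟨f₂, hf₂, hf₂g⟩ := ContinuousMap.exists_dist_lt_of_mem_closure hg
    (hK.union (hQ.image Φ.continuous)) (lt_min hδ₀ (show 0 < ε / (2 * n) by positivity))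
  refine ⟨k, fun _ => 1, fun _ => 0, f₂, hf₂, fun j _ p q hpq => Matrix.one_apply_ne hpq, ?_,
    hKU fun x hx => ?_⟩
  · have hle : ducc ⇑f (fun x => f₂ (headNet σ (fun _ => 1) (fun _ => 0) k x)) ≤
        ε / 2 + 3 * (2 / 3) ^ R := by
      refine ducc_le_of_eNorm_le (by positivity) fun x hx => ?_
      have hxQ : x ∈ Q := mem_closedBall_zero_iff.2 <|
        (pi_norm_le_iff_of_nonneg (Nat.cast_nonneg R)).2 hx
      have hhead : headNet σ (fun _ => 1) (fun _ => 0) k x = Φ x :=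
        funext fun i => headNet_one_zero k x i
      have hd := (hf₂g (Φ x) (Or.inr ⟨x, hxQ, rfl⟩)).le.trans (min_le_right _ _)
      have hgx : g (Φ x) = f x := hgQ ⟨x, hxQ⟩
      rw [hgx, dist_comm, dist_eq_norm] at hd
      rw [hhead]
      refine (eNorm_le_of_norm_le hd).trans (le_of_eq ?_)
      field_simp
    linarith
  · rw [← hgK x hx]
    exact (hf₂g x (Or.inl hx)).trans_le (min_le_left _ _)
end

section
/- Let μ be a finite Borel measure on ℝ^m equivalent to the Lebesgue measure μ_M, and let F ⊆ L¹_μ(ℝ^m) be such that the interior int(co(F)) of the convex hull co(F) is nonempty and co(F) ∩ int(co(F)) is dense in int(co(F)). Let σ : ℝ → ℝ be continuous, not equal to any polynomial, injective, Borel bi-measurable, with σ(x) > x outside a Borel set of μ-measure 0; let b ∈ ℝ^m have every coordinate b_i > 0, set S(x)_i = σ(x_i + b_i), assume S_#μ is absolutely continuous with respect to μ_M with ‖d(S_#μ)/dμ_M‖_{L^∞} < ∞, and let Φ(f) = f ∘ S on L¹_μ(ℝ^m). Then the set { Σ_{i=1}^n α_i Φ^N(f_i) : N, n ∈ ℕ,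 f_i ∈ F, α_i ∈ [0,1], Σ_{i=1}^n α_i = 1 } is dense in L¹_μ(ℝ^m). -/
open MeasureTheory
open scoped ENNReal

/-- Membership in `L¹_μ(ℝ^m)` (scalar-valued). -/
def MemL1s {m : ℕ} (μ : Measure (Fin m → ℝ)) (f : (Fin m → ℝ) → ℝ) : Prop :=
  Measurable f ∧ (∫⁻ x, ENNReal.ofReal |f x| ∂μ) < ⊤

/-- The convex hull (set of finite convex combinations) of `F ⊆ L¹_μ(ℝ^m)`. -/
def convComb {m : ℕ} (F : Set ((Fin m → ℝ) → ℝ)) : Set ((Fin m → ℝ) → ℝ) :=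
  {h | ∃ (k : ℕ) (α : Fin k → ℝ) (u : Fin k → (Fin m → ℝ) → ℝ),
    (∀ i, u i ∈ F) ∧ (∀ i, 0 ≤ α i) ∧ (∀ i, α i ≤ 1) ∧ (∑ i, α i) = 1 ∧
    h = fun x => ∑ i, α i * u i x}

/-- `h` is an interior point of the convex hull of `F` in the `L¹_μ` norm topology. -/
def MemIntCo {m : ℕ} (μ : Measure (Fin m → ℝ)) (F : Set ((Fin m → ℝ) → ℝ))
    (h : (Fin m → ℝ) → ℝ) : Prop :=
  MemL1s μ h ∧ ∃ r : ℝ, 0 < r ∧ ∀ g, MemL1s μ g →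
    (∫⁻ x, ENNReal.ofReal |g x - h x| ∂μ) < ENNReal.ofReal r →
    ∃ g' ∈ convComb F, g' =ᵐ[μ] g

/-- A scalar `L¹` function on `ℝ^m` is approximated in `L¹_μ` by bounded measurable functions. -/
lemma MemL1s.exists_bounded_lintegral_sub_lt {m : ℕ} {μ : Measure (Fin m → ℝ)}
    [IsFiniteMeasure μ] {f : (Fin m → ℝ) → ℝ} (hf : MemL1s μ f) {ε : ℝ} (hε : 0 < ε) :
    ∃ (g : (Fin m → ℝ) → ℝ) (C : ℝ), Measurable g ∧ (∀ x, |g x| ≤ C) ∧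
      ∫⁻ x, ENNReal.ofReal |g x - f x| ∂μ < ENNReal.ofReal ε := by
  have hfi : Integrable f μ := by
    refine ⟨hf.1.aestronglyMeasurable, ?_⟩
    simpa only [HasFiniteIntegral, Real.enorm_eq_ofReal_abs] using hf.2
  obtain ⟨g, hg, -⟩ := hfi.exists_boundedContinuous_lintegral_sub_le
    (ε := ENNReal.ofReal (ε / 2)) (by simpa using hε)
  refine ⟨g, ‖g‖, g.continuous.measurable, fun x => g.norm_coe_le_norm x, ?_⟩
  refine lt_of_le_of_lt ?_ ((ENNReal.ofReal_lt_ofReal_iff hε).2 (half_lt_self hε))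
  simpa only [Real.enorm_eq_ofReal_abs, abs_sub_comm] using hg

/-- The triangle inequality for the `L¹_μ` distance, with explicit bounds. -/
lemma lintegral_abs_sub_lt_of_lt_half {m : ℕ} {μ : Measure (Fin m → ℝ)}
    {f g h : (Fin m → ℝ) → ℝ} (hf : Measurable f) (hg : Measurable g) {r : ℝ} (hr : 0 < r)
    (hfg : ∫⁻ x, ENNReal.ofReal |f x - g x| ∂μ < ENNReal.ofReal (r / 2))
    (hgh : ∫⁻ x, ENNReal.ofReal |g x - h x| ∂μ < ENNReal.ofReal (r / 2)) :
    ∫⁻ x, ENNReal.ofReal |f x - h x| ∂μ < ENNReal.ofReal r := by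
  calc ∫⁻ x, ENNReal.ofReal |f x - h x| ∂μ
      ≤ ∫⁻ x, (ENNReal.ofReal |f x - g x| + ENNReal.ofReal |g x - h x|) ∂μ := by
        refine lintegral_mono fun x => ?_
        rw [← ENNReal.ofReal_add (abs_nonneg _) (abs_nonneg _)]
        exact ENNReal.ofReal_le_ofReal (abs_sub_le _ _ _)
    _ = ∫⁻ x, ENNReal.ofReal |f x - g x| ∂μ + ∫⁻ x, ENNReal.ofReal |g x - h x| ∂μ :=
        lintegral_add_left (by fun_prop) _
    _ < ENNReal.ofReal (r / 2) + ENNReal.ofReal (r / 2) := ENNReal.add_lt_add hfg hgh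
    _ = ENNReal.ofReal r := by
        rw [← ENNReal.ofReal_add (by positivity) (by positivity), add_halves]

/-- Two functions bounded by `C` that agree off a set `A` are at `L¹_μ` distance at most
`2 * C * μ A`. -/
lemma lintegral_abs_sub_le_of_eqOn_compl {m : ℕ} {μ : Measure (Fin m → ℝ)}
    {f g : (Fin m → ℝ) → ℝ} {C : ℝ} (hf : ∀ x, |f x| ≤ C) (hg : ∀ x, |g x| ≤ C)
    {A : Set (Fin m → ℝ)} (hA : MeasurableSet A) (hfg : Set.EqOn f g Aᶜ) :
    ∫⁻ x, ENNReal.ofReal |f x - g x| ∂μ ≤ ENNReal.ofReal (2 * C) * μ A := by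
  rw [← lintegral_indicator_const hA]
  refine lintegral_mono fun x => ?_
  by_cases hx : x ∈ A
  · rw [Set.indicator_of_mem hx]
    refine ENNReal.ofReal_le_ofReal ((abs_sub _ _).trans ?_)
    linarith [hf x, hg x]
  · simp [hfg hx]

/-- Coordinate half-spaces escaping to `-∞` have small measure. -/
lemma exists_const_mul_measure_coord_lt_lt {m : ℕ} (μ : Measure (Fin m → ℝ))
    [IsFiniteMeasure μ] (i : Fin m) (c : ℝ) {ε : ℝ} (hε : 0 < ε) :
    ∃ R : ℝ, ENNReal.ofReal c * μ {x | x i < -R} < ENNReal.ofReal ε := by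
  have h : Filter.Tendsto (fun n : ℕ => μ {x : Fin m → ℝ | x i < -(n : ℝ)}) Filter.atTop
      (nhds (μ (⋂ n : ℕ, {x : Fin m → ℝ | x i < -(n : ℝ)}))) := by
    refine tendsto_measure_iInter_atTop
      (fun n => (measurableSet_lt (measurable_pi_apply i) measurable_const).nullMeasurableSet)
      (fun a b hab x hx => ?_) ⟨0, measure_ne_top _ _⟩
    have : (a : ℝ) ≤ b := by exact_mod_cast hab
    simp only [Set.mem_ofPred_eq] at hx ⊢
    linarith
  have hempty : (⋂ n : ℕ, {x : Fin m → ℝ | x i < -(n : ℝ)}) = ∅ := by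
    refine Set.eq_empty_of_forall_notMem fun x hx => ?_
    obtain ⟨n, hn⟩ := exists_nat_gt (-x i)
    have := Set.mem_iInter.1 hx n
    simp only [Set.mem_ofPred_eq] at this
    linarith
  rw [hempty, measure_empty] at h
  have h' := ENNReal.Tendsto.const_mul (a := ENNReal.ofReal c) h (Or.inr ENNReal.ofReal_ne_top)
  rw [mul_zero] at h'
  obtain ⟨n, hn⟩ := (h'.eventually_lt_const (ENNReal.ofReal_pos.2 hε)).exists
  exact ⟨n, hn⟩

/-- Coordinate half-spaces escaping to `+∞` along an arithmetic progression have small measure. -/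
lemma exists_const_mul_measure_le_coord_lt {m : ℕ} (μ : Measure (Fin m → ℝ))
    [IsFiniteMeasure μ] (i : Fin m) (a c : ℝ) {d : ℝ} (hd : 0 < d) {ε : ℝ} (hε : 0 < ε) :
    ∃ N : ℕ, ENNReal.ofReal c * μ {x | a + N * d ≤ x i} < ENNReal.ofReal ε := by
  have hmono : Monotone fun n : ℕ => a + n * d := fun k l hkl => by
    have : (k : ℝ) ≤ l := by exact_mod_cast hkl
    simp only
    gcongr
  have h : Filter.Tendsto (fun n : ℕ => μ {x : Fin m → ℝ | a + n * d ≤ x i}) Filter.atTop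
      (nhds (μ (⋂ n : ℕ, {x : Fin m → ℝ | a + n * d ≤ x i}))) :=
    tendsto_measure_iInter_atTop
      (fun n => (measurableSet_le measurable_const (measurable_pi_apply i)).nullMeasurableSet)
      (fun k l hkl x hx => (hmono hkl).trans hx) ⟨0, measure_ne_top _ _⟩
  have hempty : (⋂ n : ℕ, {x : Fin m → ℝ | a + n * d ≤ x i}) = ∅ := by
    refine Set.eq_empty_of_forall_notMem fun x hx => ?_
    obtain ⟨n, hn⟩ := exists_nat_gt ((x i - a) / d)
    have := Set.mem_iInter.1 hx n
    simp only [Set.mem_ofPred_eq] at this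
    rw [div_lt_iff₀ hd] at hn
    linarith
  rw [hempty, measure_empty] at h
  have h' := ENNReal.Tendsto.const_mul (a := ENNReal.ofReal c) h (Or.inr ENNReal.ofReal_ne_top)
  rw [mul_zero] at h'
  exact (h'.eventually_lt_const (ENNReal.ofReal_pos.2 hε)).exists

/-- If `T` is a measurable embedding mapping `K` into `A`, then bounded functions `f`, `h` can be
interpolated: some `g` agrees with `h` off `A` while `g ∘ T` agrees with `f` on `K`. -/
lemma MeasurableEmbedding.exists_comp_eqOn_and_eqOn_compl {α : Type*} [MeasurableSpace α]
    {T : α → α} (hT : MeasurableEmbedding T) {K A : Set α} (hK : MeasurableSet K)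
    (hKA : Set.MapsTo T K A) {f h : α → ℝ} (hf : Measurable f) (hh : Measurable h) {C : ℝ}
    (hfC : ∀ x, |f x| ≤ C) (hhC : ∀ x, |h x| ≤ C) :
    ∃ g : α → ℝ, Measurable g ∧ (∀ x, |g x| ≤ C) ∧ Set.EqOn (g ∘ T) f K ∧ Set.EqOn g h Aᶜ := by
  classical
  have hφ : Measurable (K.piecewise f (h ∘ T)) := hf.piecewise hK (hh.comp hT.measurable)
  refine ⟨Function.extend T (K.piecewise f (h ∘ T)) h, hT.measurable_extend hφ hh,
    fun x => ?_, fun x hx => ?_, fun x hx => ?_⟩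
  · by_cases hx : ∃ y, T y = x
    · obtain ⟨y, rfl⟩ := hx
      rw [hT.injective.extend_apply]
      by_cases hy : y ∈ K
      · simpa [hy] using hfC y
      · simpa [hy] using hhC (T y)
    · rw [Function.extend_apply' _ _ _ hx]
      exact hhC x
  · rw [Function.comp_apply, hT.injective.extend_apply, Set.piecewise_eq_of_mem _ _ _ hx]
  · by_cases hx' : ∃ y, T y = x
    · obtain ⟨y, rfl⟩ := hx'
      have hy : y ∉ K := fun hy => hx (hKA hy)
      rw [hT.injective.extend_apply, Set.piecewise_eq_of_notMem _ _ _ hy, Function.comp_apply]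
    · exact Function.extend_apply' _ _ _ hx'

/-- If `T` raises the `i`-th coordinate by at least `d`, then `T^[N]` raises it by `N * d`. -/
lemma add_nat_mul_le_iterate_coord {ι : Type*} {T : (ι → ℝ) → ι → ℝ} {i : ι} {d : ℝ}
    (hT : ∀ x, x i + d ≤ T x i) (N : ℕ) (x : ι → ℝ) : x i + N * d ≤ T^[N] x i := by
  induction N with
  | zero => simp
  | succ n ih =>
    rw [Function.iterate_succ_apply']
    push_cast
    linarith [hT (T^[n] x)]

/-- convex combinations of iterated composition-operator images of `F` are
dense in `L¹_μ(ℝ^m)` (Corollary 4.13 (iii)). -/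
theorem stmt_17 {m : ℕ} (hm : 0 < m)
    (μ : Measure (Fin m → ℝ)) [IsFiniteMeasure μ]
    (hμ₁ : μ ≪ (volume : Measure (Fin m → ℝ)))
    (hμ₂ : (volume : Measure (Fin m → ℝ)) ≪ μ)
    (F : Set ((Fin m → ℝ) → ℝ)) (hF : ∀ f ∈ F, MemL1s μ f)
    (hint : ∃ h, MemIntCo μ F h)
    (hdense : ∀ h, MemIntCo μ F h → ∀ η > (0 : ℝ),
      ∃ g, g ∈ convComb F ∧ MemIntCo μ F g ∧
        (∫⁻ x, ENNReal.ofReal |g x - h x| ∂μ) < ENNReal.ofReal η)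
    (σ : ℝ → ℝ) (hσ : Continuous σ)
    (hpoly : ∀ p : Polynomial ℝ, σ ≠ fun x => Polynomial.eval x p)
    (hinj : Function.Injective σ)
    (hbi : ∀ B : Set ℝ, MeasurableSet B → MeasurableSet (σ '' B))
    (hgrow : ∃ B : Set ℝ, MeasurableSet B ∧ volume B = 0 ∧ ∀ x ∉ B, x < σ x)
    (b : Fin m → ℝ) (hb : ∀ i, 0 < b i)
    (S : (Fin m → ℝ) → (Fin m → ℝ)) (hS : S = fun x i => σ (x i + b i))
    (hac : μ.map S ≪ (volume : Measure (Fin m → ℝ)))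
    (hbdd : essSup ((μ.map S).rnDeriv (volume : Measure (Fin m → ℝ)))
      (volume : Measure (Fin m → ℝ)) ≠ ⊤) :
    ∀ f, MemL1s μ f → ∀ ε > (0 : ℝ),
      ∃ (N k : ℕ) (α : Fin k → ℝ) (u : Fin k → (Fin m → ℝ) → ℝ),
        (∀ i, u i ∈ F) ∧ (∀ i, 0 ≤ α i) ∧ (∀ i, α i ≤ 1) ∧ (∑ i, α i) = 1 ∧
        (∫⁻ x, ENNReal.ofReal |(∑ i, α i * u i (S^[N] x)) - f x| ∂μ) <
          ENNReal.ofReal ε := by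
  intro f hf ε hε
  have hσ_le : ∀ x, x ≤ σ x := by
    obtain ⟨B, -, hB0, hB⟩ := hgrow
    have hdense' : Dense {x | x ≤ σ x} := by
      refine Measure.dense_of_ae (μ := (volume : Measure ℝ)) ?_
      filter_upwards [measure_eq_zero_iff_ae_notMem.1 hB0] with x hx
      exact (hB x hx).le
    have hclosed : IsClosed {x | x ≤ σ x} := isClosed_le continuous_id hσ
    intro x
    have hx : x ∈ closure {x | x ≤ σ x} := hdense' x
    rwa [hclosed.closure_eq] at hx
  have hS_cont : Continuous S := by
    rw [hS]
    fun_prop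
  have hS_inj : Function.Injective S := by
    intro x y hxy
    ext i
    have := congrFun hxy i
    simp only [hS] at this
    exact add_right_cancel (hinj this)
  have hS_qmp : Measure.QuasiMeasurePreserving S μ μ :=
    ⟨hS_cont.measurable, hac.trans hμ₂⟩
  let i : Fin m := ⟨0, hm⟩
  have hS_coord : ∀ x, x i + b i ≤ S x i := fun x => by
    simpa only [hS] using hσ_le (x i + b i)
  obtain ⟨h, hhL1, r, hr, hball⟩ := hint
  obtain ⟨h', C₁, hh'_meas, hh'_bdd, hh'⟩ :=
    hhL1.exists_bounded_lintegral_sub_lt (half_pos hr)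
  obtain ⟨f', C₂, hf'_meas, hf'_bdd, hf'⟩ := hf.exists_bounded_lintegral_sub_lt (half_pos hε)
  let C := max C₁ C₂
  have hh'C : ∀ x, |h' x| ≤ C := fun x => (hh'_bdd x).trans (le_max_left _ _)
  have hf'C : ∀ x, |f' x| ≤ C := fun x => (hf'_bdd x).trans (le_max_right _ _)
  obtain ⟨R, hR⟩ := exists_const_mul_measure_coord_lt_lt μ i (2 * C) (half_pos hε)
  obtain ⟨N, hN⟩ := exists_const_mul_measure_le_coord_lt μ i (-R) (2 * C) (hb i) (half_pos hr)
  have hcompl : {x : Fin m → ℝ | x i < -R} = {x | -R ≤ x i}ᶜ := by ext; simp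
  obtain ⟨g, hg_meas, hgC, hgf, hgh⟩ :=
    ((hS_cont.iterate N).measurableEmbedding
      (hS_inj.iterate N)).exists_comp_eqOn_and_eqOn_compl
      (K := {x | -R ≤ x i}) (A := {x | -R + N * b i ≤ x i})
      (measurableSet_le measurable_const (measurable_pi_apply i))
      (fun x (hx : -R ≤ x i) => show -R + N * b i ≤ S^[N] x i by
        linarith [add_nat_mul_le_iterate_coord hS_coord N x])
      hf'_meas hh'_meas hf'C hh'C
  have hgL1 : MemL1s μ g := by
    refine ⟨hg_meas, (lintegral_mono fun x => ENNReal.ofReal_le_ofReal (hgC x)).trans_lt ?_⟩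
    rw [lintegral_const]
    exact ENNReal.mul_lt_top ENNReal.ofReal_lt_top (measure_lt_top _ _)
  have hgh_lt : ∫⁻ x, ENNReal.ofReal |g x - h x| ∂μ < ENNReal.ofReal r :=
    lintegral_abs_sub_lt_of_lt_half hg_meas hh'_meas hr
      ((lintegral_abs_sub_le_of_eqOn_compl hgC hh'C
        (measurableSet_le measurable_const (measurable_pi_apply i)) hgh).trans_lt hN) hh'
  obtain ⟨g', ⟨k, α, u, hu, hα0, hα1, hαs, rfl⟩, hg'⟩ := hball g hgL1 hgh_lt
  refine ⟨N, k, α, u, hu, hα0, hα1, hαs, ?_⟩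
  have hae : ∀ᵐ x ∂μ, ∑ j, α j * u j (S^[N] x) = g (S^[N] x) := (hS_qmp.iterate N).ae hg'
  rw [lintegral_congr_ae (g := fun x => ENNReal.ofReal |(g ∘ S^[N]) x - f x|)
    (hae.mono fun x hx => by simp only [hx, Function.comp_apply])]
  refine lintegral_abs_sub_lt_of_lt_half
    (hg_meas.comp (hS_cont.iterate N).measurable) hf'_meas hε ?_ hf'
  exact (lintegral_abs_sub_le_of_eqOn_compl (fun x => hgC _) hf'C
    (measurableSet_lt (measurable_pi_apply i) measurable_const)
    (by rwa [hcompl, compl_compl])).trans_lt hR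
end
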